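/- Let p ≥ 3 be a prime, let N_1, N_2 be integers with 2 ≤ N_1, N_2 < p, let I_1 = [1, N_1] and I_2 = [1, N_2], let k_1, k_2 be positive integers, let a be an integer with gcd(a,p) = 1, and let α_1(x_1), α_2(x_2) be complex numbers with |α_1(x_1)| ≤ 1 and |α_2(x_2)| ≤ 1. Then |∑_{x_1∈I_1} ∑_{x_2∈I_2} α_1(x_1) α_2(x_2) e_p(a x_1* x_2*)| ≤ (2k_1)^{45k_1²/k_2}·(2k_2)^{45k_2²/k_1}·(log p)^{2(k_1/k_2 + k_2/k_1)}·(N_1^{k_1−1}/p^{1/2} + p^{1/2}/N_1^{k_1})^{1/(2k_1k_2)}·(N_2^{k_2−1}/p^{1/2} + p^{1/2}/N_2^{k_2})^{1/(2k_1k_2)}·N_1·N_2. -/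

import Mathlib

open Finset
/-- `e_p(z) = exp(2πi z/p)` for `z ∈ ZMod p`. -/
noncomputable def ep (p : ℕ) (z : ZMod p) : ℂ :=
  Complex.exp (2 * (Real.pi : ℂ) * Complex.I * (z.val : ℂ) / (p : ℂ))

section Decomposition

variable {ι : Type*} [Fintype ι] [DecidableEq ι]

/-- The tuple whose `i`-th entry is the product of the `d s`, each taken as often as `i` occurs
in `s`. -/
def incidenceProd (r : ℕ) (d : (Fin r → ι) → ℕ) : ι → ℕ :=
  ∏ s, ∏ l, Pi.mulSingle (s l) (d s)

lemma incidenceProd_one (r : ℕ) : incidenceProd r (1 : (Fin r → ι) → ℕ) = 1 := by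
  simp [incidenceProd]

lemma incidenceProd_mul (r : ℕ) (d e : (Fin r → ι) → ℕ) :
    incidenceProd r (d * e) = incidenceProd r d * incidenceProd r e := by
  simp [incidenceProd, Pi.mulSingle_mul, prod_mul_distrib]

lemma incidenceProd_mulSingle (r : ℕ) (s : Fin r → ι) (q : ℕ) :
    incidenceProd r (Pi.mulSingle s q) = ∏ l, Pi.mulSingle (s l) q := by
  unfold incidenceProd
  rw [Fintype.prod_eq_single s]
  · simp
  · intro t ht
    simp [ht]

lemma prod_prod_mulSingle {κ : Type*} (S : Finset κ) (f : κ → ι) (q : κ → ℕ) :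
    ∏ i, (∏ l ∈ S, Pi.mulSingle (f l) (q l)) i = ∏ l ∈ S, q l := by
  simp only [Finset.prod_apply]
  rw [prod_comm]
  refine prod_congr rfl fun l _ => ?_
  rw [Fintype.prod_eq_single (f l)]
  · simp
  · intro t ht
    simp [ht]

lemma prod_incidenceProd (r : ℕ) (d : (Fin r → ι) → ℕ) :
    ∏ i, incidenceProd r d i = ∏ s, d s ^ r := by
  simp only [incidenceProd, Finset.prod_apply]
  rw [prod_comm]
  refine prod_congr rfl fun s _ => ?_
  have := prod_prod_mulSingle univ s fun _ => d s
  simpa [Finset.prod_apply] using this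

lemma dvd_incidenceProd (r : ℕ) (d : (Fin r → ι) → ℕ) (s : Fin r → ι) (l : Fin r) :
    d s ∣ incidenceProd r d (s l) := by
  simp only [incidenceProd, Finset.prod_apply]
  refine dvd_trans ?_ (dvd_prod_of_mem _ (mem_univ s))
  refine dvd_trans ?_ (dvd_prod_of_mem _ (mem_univ l))
  simp

lemma exists_eq_prod_mulSingle_mul {q : ℕ} (hq : q.Prime) (r : ℕ) (x : ι → ℕ)
    (h : q ^ r ∣ ∏ i, x i) :
    ∃ (s : Fin r → ι) (y : ι → ℕ), x = (∏ l, Pi.mulSingle (s l) q) * y := by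
  induction r generalizing x with
  | zero => exact ⟨Fin.elim0, x, by simp⟩
  | succ r ih =>
    obtain ⟨i, -, hi⟩ := (hq.prime.dvd_finsetProd_iff _).1 ((dvd_pow_self q r.succ_ne_zero).trans h)
    obtain ⟨c, hc⟩ := hi
    have hx : x = Pi.mulSingle i q * Function.update x i c := by
      ext j
      by_cases hj : j = i
      · subst hj; simpa using hc
      · simp [hj]
    have hp : ∏ j, x j = q * ∏ j, Function.update x i c j := by
      conv_lhs => rw [hx]
      have := prod_prod_mulSingle {()} (fun _ => i) fun _ => q
      simp only [prod_singleton] at this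
      simp only [Pi.mul_apply, prod_mul_distrib, this]
    obtain ⟨s, y, hy⟩ := ih (Function.update x i c) (by
      rw [hp, pow_succ'] at h
      exact Nat.dvd_of_mul_dvd_mul_left hq.pos h)
    refine ⟨Fin.cons i s, y, ?_⟩
    rw [Fin.prod_univ_succ]
    simp only [Fin.cons_zero, Fin.cons_succ]
    rw [mul_assoc, ← hy, ← hx]

lemma exists_incidenceProd_eq (x : ι → ℕ) (hx : ∀ i, x i ≠ 0)
    (hsq : ∀ q : ℕ, q.Prime → q ∣ ∏ i, x i → q ^ 2 ∣ ∏ i, x i) :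
    ∃ (d : (Fin 2 → ι) → ℕ) (t : (Fin 3 → ι) → ℕ),
      incidenceProd 2 d * incidenceProd 3 t = x := by
  induction hn : ∏ i, x i using Nat.strong_induction_on generalizing x with
  | _ n ih =>
  subst hn
  by_cases h1 : ∏ i, x i = 1
  · refine ⟨1, 1, ?_⟩
    rw [incidenceProd_one, incidenceProd_one]
    ext i
    have := (prod_eq_one_iff_of_one_le' (fun i _ => Nat.one_le_iff_ne_zero.2 (hx i))).1 h1 i
      (mem_univ i)
    simpa using this.symm
  have hq := Nat.minFac_prime h1
  set q := (∏ i, x i).minFac with hqdef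
  have key : ∀ r, r ≠ 0 → q ^ r ∣ ∏ i, x i →
      (q ^ (r + 1) ∣ ∏ i, x i → q ^ (r + 2) ∣ ∏ i, x i) →
      ∃ (s : Fin r → ι) (d : (Fin 2 → ι) → ℕ) (t : (Fin 3 → ι) → ℕ),
        (∏ l, Pi.mulSingle (s l) q) * (incidenceProd 2 d * incidenceProd 3 t) = x := by
    intro r hr hdvd hstep
    obtain ⟨s, y, hy⟩ := exists_eq_prod_mulSingle_mul hq r x hdvd
    have hy0 : ∀ i, y i ≠ 0 := fun i h0 => hx i (by rw [hy]; simp [h0])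
    have hprod : ∏ i, x i = q ^ r * ∏ i, y i := by
      conv_lhs => rw [hy]
      simp only [Pi.mul_apply, prod_mul_distrib]
      rw [prod_prod_mulSingle]
      simp
    have hqr : 0 < q ^ r := pow_pos hq.pos r
    obtain ⟨d, t, hdt⟩ := ih (∏ i, y i) (by
        rw [hprod]
        exact lt_mul_left (Nat.pos_of_ne_zero (prod_ne_zero_iff.2 fun i _ => hy0 i))
          (Nat.one_lt_pow hr hq.one_lt)) y hy0 (by
        intro l hl hly
        by_cases hlq : l = q
        · subst hlq
          rw [hprod, pow_add, pow_add] at hstep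
          refine Nat.dvd_of_mul_dvd_mul_left hqr (hstep ?_)
          simpa using Nat.mul_dvd_mul_left _ hly
        · have h2 := hsq l hl (hprod ▸ dvd_mul_of_dvd_right hly _)
          rw [hprod] at h2
          exact (Nat.Coprime.pow _ _ ((Nat.coprime_primes hl hq).2 hlq)).dvd_of_dvd_mul_left h2)
        rfl
    exact ⟨s, d, t, by rw [hdt, ← hy]⟩
  have h2 := hsq q hq (Nat.minFac_dvd _)
  by_cases h3 : q ^ 3 ∣ ∏ i, x i ∧ ¬ q ^ 4 ∣ ∏ i, x i
  · obtain ⟨s, d, t, h⟩ := key 3 (by norm_num) h3.1 (fun h => absurd h h3.2)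
    refine ⟨d, Pi.mulSingle s q * t, ?_⟩
    rw [incidenceProd_mul, incidenceProd_mulSingle, ← h, mul_left_comm]
  · obtain ⟨s, d, t, h⟩ := key 2 (by norm_num) h2 (fun h => by tauto)
    refine ⟨Pi.mulSingle s q * d, t, ?_⟩
    rw [incidenceProd_mul, incidenceProd_mulSingle, ← h, mul_assoc]

end Decomposition

section FullProduct

variable {ι : Type*} [Fintype ι] [DecidableEq ι]

/-- Rankin's trick for tuples whose product is a squarefull number. -/
lemma card_le_of_prod_squarefull (N : ℕ) (S : Finset (ι → ℕ))
    (hS : ∀ x ∈ S, ∀ i, x i ∈ Icc 1 N)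
    (hsq : ∀ x ∈ S, ∀ q : ℕ, q.Prime → q ∣ ∏ i, x i → q ^ 2 ∣ ∏ i, x i) :
    (#S : ℝ) ≤ √N ^ Fintype.card ι *
      ((∑ m ∈ Icc 1 N, ((√(m : ℝ))⁻¹) ^ 2) ^ Fintype.card ι ^ 2 *
        (∑ m ∈ Icc 1 N, ((√(m : ℝ))⁻¹) ^ 3) ^ Fintype.card ι ^ 3) := by
  classical
  have hpos : ∀ x ∈ S, ∀ i, x i ≠ 0 := fun x hx i => by
    have := mem_Icc.1 (hS x hx i); omega
  have hex : ∀ x : ι → ℕ, ∃ dt : ((Fin 2 → ι) → ℕ) × ((Fin 3 → ι) → ℕ),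
      x ∈ S → incidenceProd 2 dt.1 * incidenceProd 3 dt.2 = x := by
    intro x
    by_cases hx : x ∈ S
    · obtain ⟨d, t, h⟩ := exists_incidenceProd_eq x (hpos x hx) (hsq x hx)
      exact ⟨(d, t), fun _ => h⟩
    · exact ⟨1, fun h => absurd h hx⟩
  choose P hP using hex
  set F : ((Fin 2 → ι) → ℕ) × ((Fin 3 → ι) → ℕ) → ℝ := fun dt =>
    (∏ s, ((√(dt.1 s : ℝ))⁻¹) ^ 2) * ∏ s, ((√(dt.2 s : ℝ))⁻¹) ^ 3 with hF
  have hle : ∀ x ∈ S, 1 ≤ √N ^ Fintype.card ι * F (P x) := by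
    intro x hx
    have hFx : F (P x) = ∏ i, (√(x i : ℝ))⁻¹ := by
      have h1 : (∏ i, x i : ℕ) = (∏ s, (P x).1 s ^ 2) * ∏ s, (P x).2 s ^ 3 := by
        rw [← prod_incidenceProd, ← prod_incidenceProd, ← prod_mul_distrib]
        exact prod_congr rfl fun i _ => (congrFun (hP x hx) i).symm
      have hw : ∀ a b : ℕ, (√((a * b : ℕ) : ℝ))⁻¹ = (√(a : ℝ))⁻¹ * (√(b : ℝ))⁻¹ := fun a b => by
        rw [Nat.cast_mul, Real.sqrt_mul (Nat.cast_nonneg a), mul_inv]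
      let w : ℕ →* ℝ := ⟨⟨fun n => (√(n : ℝ))⁻¹, by simp⟩, hw⟩
      have h2 := congrArg w h1
      rw [map_mul, map_prod, map_prod, map_prod] at h2
      simp only [map_pow] at h2
      exact h2.symm
    rw [hFx, ← Finset.card_univ, ← prod_const, ← prod_mul_distrib]
    refine le_of_eq_of_le (prod_const_one (s := univ)).symm
      (prod_le_prod (fun _ _ => zero_le_one) fun i _ => ?_)
    have hi := mem_Icc.1 (hS x hx i)
    rw [← div_eq_mul_inv, one_le_div (Real.sqrt_pos.2 (by exact_mod_cast hi.1))]
    exact Real.sqrt_le_sqrt (by exact_mod_cast hi.2)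
  have hmem : ∀ x ∈ S, P x ∈ (Fintype.piFinset fun _ : Fin 2 → ι => Icc 1 N) ×ˢ
      (Fintype.piFinset fun _ : Fin 3 → ι => Icc 1 N) := by
    intro x hx
    have aux : ∀ m i, m ∣ x i → m ∈ Icc 1 N := fun m i hm => by
      have hi := mem_Icc.1 (hS x hx i)
      exact mem_Icc.2 ⟨Nat.pos_of_dvd_of_pos hm hi.1, (Nat.le_of_dvd hi.1 hm).trans hi.2⟩
    simp only [mem_product, Fintype.mem_piFinset]
    constructor
    · intro s
      refine aux _ (s 0) ?_
      conv_rhs => rw [← hP x hx]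
      exact dvd_mul_of_dvd_left (dvd_incidenceProd 2 _ s 0) _
    · intro s
      refine aux _ (s 0) ?_
      conv_rhs => rw [← hP x hx]
      exact dvd_mul_of_dvd_right (dvd_incidenceProd 3 _ s 0) _
  have hinj : Set.InjOn P S := fun x hx y hy h => by
    rw [← hP x hx, ← hP y hy, h]
  calc (#S : ℝ) = ∑ x ∈ S, 1 := by simp
    _ ≤ ∑ x ∈ S, √N ^ Fintype.card ι * F (P x) := sum_le_sum hle
    _ = √N ^ Fintype.card ι * ∑ z ∈ S.image P, F z := by
        rw [sum_image hinj, mul_sum]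
    _ ≤ √N ^ Fintype.card ι * ∑ z ∈ (Fintype.piFinset fun _ : Fin 2 → ι => Icc 1 N) ×ˢ
          (Fintype.piFinset fun _ : Fin 3 → ι => Icc 1 N), F z := by
        refine mul_le_mul_of_nonneg_left ?_ (by positivity)
        refine sum_le_sum_of_subset_of_nonneg (image_subset_iff.2 hmem) fun z _ _ => ?_
        simp only [hF]
        positivity
    _ = _ := by
        congr 1
        rw [sum_product]
        simp only [hF]
        rw [← sum_mul_sum, ← prod_univ_sum (fun _ => Icc 1 N) fun _ (m : ℕ) => ((√(m : ℝ))⁻¹) ^ 2,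
          ← prod_univ_sum (fun _ => Icc 1 N) fun _ (m : ℕ) => ((√(m : ℝ))⁻¹) ^ 3]
        simp

lemma sum_inv_sqrt_sq_le (N : ℕ) :
    ∑ m ∈ Icc 1 N, ((√(m : ℝ))⁻¹) ^ 2 ≤ 1 + Real.log N := by
  refine le_of_eq_of_le ?_ (harmonic_le_one_add_log N)
  rw [harmonic_eq_sum_Icc]
  push_cast
  refine sum_congr rfl fun m _ => ?_
  rw [inv_pow, Real.sq_sqrt (Nat.cast_nonneg m)]

lemma sum_inv_sqrt_cube_le (N : ℕ) : ∑ m ∈ Icc 1 N, ((√(m : ℝ))⁻¹) ^ 3 ≤ 3 := by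
  have key : ∀ n : ℕ, ∑ m ∈ Icc 1 (n + 1), ((√(m : ℝ))⁻¹) ^ 3 ≤
      3 - 2 * (√((n + 1 : ℕ) : ℝ))⁻¹ := by
    intro n
    induction n with
    | zero => norm_num
    | succ n ih =>
      rw [sum_Icc_succ_top (by omega)]
      have ha : 0 < √((n + 1 : ℕ) : ℝ) := by positivity
      have hb : 0 < √((n + 1 + 1 : ℕ) : ℝ) := by positivity
      have hab : √((n + 1 + 1 : ℕ) : ℝ) ^ 2 = √((n + 1 : ℕ) : ℝ) ^ 2 + 1 := by
        rw [Real.sq_sqrt (by positivity), Real.sq_sqrt (by positivity)]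
        push_cast; ring
      set a := √((n + 1 : ℕ) : ℝ)
      set b := √((n + 1 + 1 : ℕ) : ℝ)
      have hle : a ≤ b := by nlinarith
      have : (b⁻¹) ^ 3 ≤ 2 * a⁻¹ - 2 * b⁻¹ := by
        have h1 : 2 * a⁻¹ - 2 * b⁻¹ - (b⁻¹) ^ 3 = (2 * b ^ 2 * (b - a) - a) / (a * b ^ 3) := by
          field_simp
        have h2 : 0 ≤ 2 * b ^ 2 * (b - a) - a := by
          have h3 : (b - a) * (b + a) = 1 := by linarith [hab, sq_sub_sq b a]
          have h4 : (2 * b ^ 2 * (b - a) - a) * (b + a) = 2 * b ^ 2 - a * (b + a) := by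
            linear_combination 2 * b ^ 2 * h3
          by_contra! hneg
          nlinarith [mul_neg_of_neg_of_pos hneg (add_pos hb ha), mul_nonneg (sub_nonneg.2 hle) ha.le]
        have : 0 ≤ (2 * b ^ 2 * (b - a) - a) / (a * b ^ 3) := by positivity
        linarith
      linarith
  rcases N with _ | n
  · norm_num
  · have := key n
    have h0 : 0 ≤ (√((n + 1 : ℕ) : ℝ))⁻¹ := by positivity
    linarith

/-- A vanishing signed sum of reciprocals forces the product of the entries to be squarefull. -/
lemma sq_dvd_prod_of_sum_div_eq_zero (x : ι → ℕ) (hx : ∀ i, x i ≠ 0) (ε : ι → ℤ)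
    (hε : ∀ i, IsUnit (ε i)) (h : ∑ i, (ε i : ℚ) / x i = 0) {q : ℕ} (hq : q.Prime)
    (hdvd : q ∣ ∏ i, x i) : q ^ 2 ∣ ∏ i, x i := by
  obtain ⟨i, -, hi⟩ := (hq.prime.dvd_finsetProd_iff _).1 hdvd
  have hz : ∑ l, ε l * ∏ j ∈ univ.erase l, (x j : ℤ) = 0 := by
    have : (∑ l, (ε l : ℚ) / x l) * ∏ j, (x j : ℚ) = 0 := by rw [h, zero_mul]
    rw [sum_mul] at this
    have h2 : ∑ l, (ε l : ℚ) * ∏ j ∈ univ.erase l, (x j : ℚ) = 0 := by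
      rw [← this]
      refine sum_congr rfl fun l _ => ?_
      rw [← mul_prod_erase univ (fun j => (x j : ℚ)) (mem_univ l)]
      have : (x l : ℚ) ≠ 0 := by exact_mod_cast hx l
      field_simp
    exact_mod_cast h2
  rw [← add_sum_erase _ _ (mem_univ i)] at hz
  have hrest : (q : ℤ) ∣ ∑ l ∈ univ.erase i, ε l * ∏ j ∈ univ.erase l, (x j : ℤ) := by
    refine dvd_sum fun l hl => dvd_mul_of_dvd_right ?_ _
    refine dvd_trans (Int.natCast_dvd_natCast.2 hi) (dvd_prod_of_mem (fun j => (x j : ℤ)) ?_)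
    exact mem_erase.2 ⟨(ne_of_mem_erase hl).symm, mem_univ i⟩
  have hmain : (q : ℤ) ∣ ε i * ∏ j ∈ univ.erase i, (x j : ℤ) := by
    rw [eq_neg_of_add_eq_zero_left hz]
    exact hrest.neg_right
  rw [(hε i).dvd_mul_left] at hmain
  rw [← mul_prod_erase univ x (mem_univ i), sq]
  exact mul_dvd_mul hi (by exact_mod_cast hmain)

end FullProduct

section Energy

/-- The `k`-tuples with entries in `[1, N]`. -/
abbrev boxTuples (k N : ℕ) : Finset (Fin k → ℕ) := Fintype.piFinset fun _ => Icc 1 N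

lemma boxTuples_pos {k N : ℕ} {x : Fin k → ℕ} (hx : x ∈ boxTuples k N) (i : Fin k) : 0 < x i :=
  (mem_Icc.1 (Fintype.mem_piFinset.1 hx i)).1

lemma boxTuples_le {k N : ℕ} {x : Fin k → ℕ} (hx : x ∈ boxTuples k N) (i : Fin k) : x i ≤ N :=
  (mem_Icc.1 (Fintype.mem_piFinset.1 hx i)).2

lemma card_sum_inv_eq_le (k N : ℕ) :
    (#{z ∈ boxTuples k N ×ˢ boxTuples k N | ∑ i, ((z.1 i : ℚ))⁻¹ = ∑ i, ((z.2 i : ℚ))⁻¹} : ℝ) ≤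
      (N : ℝ) ^ k * ((1 + Real.log N) ^ (4 * k ^ 2) * 3 ^ (8 * k ^ 3)) := by
  set Z := {z ∈ boxTuples k N ×ˢ boxTuples k N | ∑ i, ((z.1 i : ℚ))⁻¹ = ∑ i, ((z.2 i : ℚ))⁻¹}
  have hinj : Function.Injective fun z : (Fin k → ℕ) × (Fin k → ℕ) => Sum.elim z.1 z.2 := by
    rintro ⟨a, b⟩ ⟨c, d⟩ h
    simpa [Sum.elim_eq_iff] using h
  have hmem : ∀ x ∈ Z.image fun z => Sum.elim z.1 z.2, ∀ i, x i ∈ Icc 1 N := by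
    intro x hx i
    obtain ⟨z, hz, rfl⟩ := mem_image.1 hx
    have hz' := mem_product.1 (mem_filter.1 hz).1
    rcases i with i | i
    · exact Fintype.mem_piFinset.1 hz'.1 i
    · exact Fintype.mem_piFinset.1 hz'.2 i
  have h := card_le_of_prod_squarefull N (Z.image fun z => Sum.elim z.1 z.2) hmem (by
    intro x hx q hq hdvd
    refine sq_dvd_prod_of_sum_div_eq_zero x (fun i => ?_) (Sum.elim (fun _ => 1) fun _ => -1)
      ?_ ?_ hq hdvd
    · have := mem_Icc.1 (hmem x hx i); omega
    · rintro (i | i) <;> simp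
    · obtain ⟨z, hz, rfl⟩ := mem_image.1 hx
      have hz' := (mem_filter.1 hz).2
      simp only [Fintype.sum_sum_type, Sum.elim_inl, Sum.elim_inr]
      simp [div_eq_mul_inv, hz'])
  rw [card_image_of_injective _ hinj] at h
  refine h.trans ?_
  have hc : Fintype.card (Fin k ⊕ Fin k) = 2 * k := by simp; ring
  rw [hc, pow_mul, Real.sq_sqrt (Nat.cast_nonneg N), show (2 * k) ^ 2 = 4 * k ^ 2 by ring,
    show (2 * k) ^ 3 = 8 * k ^ 3 by ring]
  have h1 : (0 : ℝ) ≤ ∑ m ∈ Icc 1 N, ((√(m : ℝ))⁻¹) ^ 2 := by positivity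
  have h2 : (0 : ℝ) ≤ ∑ m ∈ Icc 1 N, ((√(m : ℝ))⁻¹) ^ 3 := by positivity
  have h3 := sum_inv_sqrt_sq_le N
  have h4 := sum_inv_sqrt_cube_le N
  have h5 : (0 : ℝ) ≤ (1 + Real.log N) ^ (4 * k ^ 2) := pow_nonneg (h1.trans h3) _
  gcongr

lemma card_le_of_separated (F : Finset ℝ) {δ L : ℝ} (hδ : 0 < δ)
    (hF : ∀ r ∈ F, 0 ≤ r ∧ r ≤ L) (hsep : ∀ r ∈ F, ∀ s ∈ F, s < r → δ ≤ r - s) (hL : 0 ≤ L) :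
    (#F : ℝ) ≤ L / δ + 1 := by
  have hcard : #F ≤ #(range (⌊L / δ⌋₊ + 1)) := by
    refine card_le_card_of_injOn (fun r => ⌊r / δ⌋₊) (fun r hr => ?_) ?_
    · have := Nat.floor_le_floor (div_le_div_of_nonneg_right (hF r hr).2 hδ.le)
      simpa using Nat.lt_succ_of_le this
    · have aux : ∀ r ∈ F, ∀ s ∈ F, ⌊r / δ⌋₊ = ⌊s / δ⌋₊ → ¬ s < r := by
        intro r hr s hs h hlt
        have h1 := hsep r hr s hs hlt
        have h2 := Nat.floor_le (div_nonneg (hF r hr).1 hδ.le)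
        have h3 := Nat.lt_floor_add_one (s / δ)
        have h4 : s / δ + 1 ≤ r / δ := by
          rw [div_add_one hδ.ne']
          exact div_le_div_of_nonneg_right (by linarith) hδ.le
        have h5 : ⌊s / δ⌋₊ + 1 ≤ ⌊r / δ⌋₊ := by
          rw [← Nat.floor_add_one (div_nonneg (hF s hs).1 hδ.le)]
          exact Nat.floor_le_floor h4
        omega
      intro r hr s hs h
      exact le_antisymm (not_lt.1 (aux r hr s hs h)) (not_lt.1 (aux s hs r hr h.symm))
  rw [card_range] at hcard
  calc (#F : ℝ) ≤ (⌊L / δ⌋₊ + 1 : ℕ) := by exact_mod_cast hcard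
    _ ≤ L / δ + 1 := by
      push_cast
      have := Nat.floor_le (div_nonneg hL hδ.le)
      linarith

/-- A family of points of `(0, U] × (0, V]` lying in a lattice of determinant at least `p`
meets few lines through the origin. -/
lemma card_slopes_le (F : Finset ℝ) {p U V : ℝ} (hp : 0 < p) (hU : 0 < U) (hV : 0 < V)
    (A B : ℝ → ℝ) (hA : ∀ r ∈ F, 0 < A r ∧ A r ≤ U) (hB : ∀ r ∈ F, 0 < B r ∧ B r ≤ V)
    (hr : ∀ r ∈ F, r = A r / B r)
    (hdet : ∀ r ∈ F, ∀ s ∈ F, s < r → p ≤ A r * B s - A s * B r) :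
    (#F : ℝ) ≤ 2 * (U * V / p + 1) := by
  have hlow : (#{r ∈ F | r ≤ U / V} : ℝ) ≤ U * V / p + 1 := by
    have := card_le_of_separated {r ∈ F | r ≤ U / V} (δ := p / V ^ 2) (L := U / V) (by positivity)
      (fun r h => by
        obtain ⟨h1, h2⟩ := mem_filter.1 h
        refine ⟨?_, h2⟩
        rw [hr r h1]
        exact (div_pos (hA r h1).1 (hB r h1).1).le)
      (fun r h s h' hlt => by
        have h1 := (mem_filter.1 h).1
        have h2 := (mem_filter.1 h').1
        have hd := hdet r h1 s h2 hlt
        have b1 := hB r h1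
        have b2 := hB s h2
        rw [hr r h1, hr s h2, div_sub_div _ _ b1.1.ne' b2.1.ne']
        have : B r * B s ≤ V ^ 2 := by rw [sq]; exact mul_le_mul b1.2 b2.2 b2.1.le hV.le
        exact div_le_div₀ (by linarith) (by linarith) (mul_pos b1.1 b2.1) this) (by positivity)
    convert this using 2
    field_simp
  have hhigh : (#{r ∈ F | ¬ r ≤ U / V} : ℝ) ≤ U * V / p + 1 := by
    have hpos : ∀ r ∈ F, 0 < r := fun r h => by
      rw [hr r h]; exact div_pos (hA r h).1 (hB r h).1
    have := card_le_of_separated ({r ∈ F | ¬ r ≤ U / V}.image fun r => r⁻¹) (δ := p / U ^ 2)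
      (L := V / U) (by positivity)
      (fun r h => by
        obtain ⟨s, hs, rfl⟩ := mem_image.1 h
        obtain ⟨h1, h2⟩ := mem_filter.1 hs
        refine ⟨(inv_pos.2 (hpos s h1)).le, ?_⟩
        rw [← inv_div]
        exact inv_anti₀ (by positivity) (not_le.1 h2).le)
      (fun r' hr' s' hs' hlt => by
        obtain ⟨r, h, rfl⟩ := mem_image.1 hr'
        obtain ⟨s, h', rfl⟩ := mem_image.1 hs'
        have h1 := (mem_filter.1 h).1
        have h2 := (mem_filter.1 h').1
        have hd := hdet s h2 r h1 ((inv_lt_inv₀ (hpos s h2) (hpos r h1)).1 hlt)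
        have a1 := hA r h1
        have a2 := hA s h2
        rw [hr r h1, hr s h2, inv_div, inv_div, div_sub_div _ _ a1.1.ne' a2.1.ne']
        have : A r * A s ≤ U ^ 2 := by rw [sq]; exact mul_le_mul a1.2 a2.2 a2.1.le hU.le
        exact div_le_div₀ (by linarith) (by linarith) (mul_pos a1.1 a2.1) this) (by positivity)
    rw [card_image_of_injective _ inv_injective] at this
    convert this using 2
    field_simp
  have := card_filter_add_card_filter_not (s := F) (fun r => r ≤ U / V)
  have : (#F : ℝ) = #{r ∈ F | r ≤ U / V} + #{r ∈ F | ¬ r ≤ U / V} := by exact_mod_cast this.symm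
  linarith

lemma card_fiber_eq_sum {X β : Type*} [DecidableEq β] (S : Finset X) (f : X → β)
    (T : Finset β) (hT : ∀ x ∈ S, f x ∈ T) :
    #{z ∈ S ×ˢ S | f z.1 = f z.2} = ∑ b ∈ T, #{x ∈ S | f x = b} ^ 2 := by
  rw [card_eq_sum_card_fiberwise (f := fun z => f z.1) (t := T)
    (fun z hz => hT _ (mem_product.1 (mem_filter.1 hz).1).1)]
  refine sum_congr rfl fun b _ => ?_
  rw [sq, ← card_product]
  congr 1
  ext z
  simp only [mem_filter, mem_product]
  grind

/-- Refining a collision count when every fibre of `f` takes few values of `g`. -/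
lemma card_collisions_le {X β γ : Type*} [DecidableEq β] [DecidableEq γ] (S : Finset X)
    (f : X → β) (g : X → γ) {M : ℝ} (hM0 : 0 ≤ M)
    (hM : ∀ b, (#({x ∈ S | f x = b}.image g) : ℝ) ≤ M) :
    (#{z ∈ S ×ˢ S | f z.1 = f z.2} : ℝ) ≤ M * #{z ∈ S ×ˢ S | g z.1 = g z.2} := by
  have h1 : ∀ b, (#{x ∈ S | f x = b} : ℝ) ^ 2 ≤
      M * #{z ∈ {x ∈ S | f x = b} ×ˢ {x ∈ S | f x = b} | g z.1 = g z.2} := by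
    intro b
    set Sb := {x ∈ S | f x = b}
    rw [card_fiber_eq_sum Sb g (Sb.image g) fun x hx => mem_image_of_mem g hx,
      card_eq_sum_card_image g Sb, Nat.cast_sum, Nat.cast_sum]
    simp only [Nat.cast_pow]
    exact sq_sum_le_card_mul_sum_sq.trans (mul_le_mul_of_nonneg_right (hM b) (by positivity))
  rw [card_fiber_eq_sum S f (S.image f) fun x hx => mem_image_of_mem f hx,
    Nat.cast_sum]
  simp only [Nat.cast_pow]
  refine (sum_le_sum fun b _ => h1 b).trans ?_
  rw [← mul_sum]
  refine mul_le_mul_of_nonneg_left ?_ hM0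
  rw [← Nat.cast_sum, Nat.cast_le, ← card_sigma]
  refine card_le_card_of_injOn (fun z => z.2) (fun z hz => ?_) ?_
  · simp only [coe_sigma, Set.mem_sigma_iff, mem_coe, mem_filter, mem_product] at hz ⊢
    tauto
  · rintro ⟨b, z⟩ hz ⟨c, w⟩ hw h
    simp only [coe_sigma, Set.mem_sigma_iff, mem_coe, mem_filter, mem_product] at hz hw h
    subst h
    have : b = c := hz.2.1.1.2.symm.trans hw.2.1.1.2
    subst this
    rfl

lemma sum_inv_mul_prod {K : Type*} [Field K] {k : ℕ} (x : Fin k → ℕ) (hx : ∀ i, (x i : K) ≠ 0) :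
    (∑ i, ((x i : K))⁻¹) * ((∏ i, x i : ℕ) : K) =
      ((∑ i, ∏ j ∈ univ.erase i, x j : ℕ) : K) := by
  push_cast
  rw [sum_mul]
  refine sum_congr rfl fun l _ => ?_
  rw [← mul_prod_erase univ (fun j => (x j : K)) (mem_univ l), ← mul_assoc,
    inv_mul_cancel₀ (hx l), one_mul]

lemma card_image_sum_inv_le {p : ℕ} [Fact p.Prime] {k N : ℕ} (hk : 0 < k) (hN : 0 < N)
    (hNp : N < p) (b : ZMod p) :
    (#({x ∈ boxTuples k N | ∑ i, ((x i : ZMod p))⁻¹ = b}.image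
      fun x => ∑ i, ((x i : ℝ))⁻¹) : ℝ) ≤ 2 * k * ((N : ℝ) ^ (2 * k - 1) / p + 1) := by
  classical
  set F := {x ∈ boxTuples k N | ∑ i, ((x i : ZMod p))⁻¹ = b}.image fun x => ∑ i, ((x i : ℝ))⁻¹
  have hex : ∀ r : ℝ, ∃ x : Fin k → ℕ, r ∈ F →
      (x ∈ boxTuples k N ∧ ∑ i, ((x i : ZMod p))⁻¹ = b) ∧ ∑ i, ((x i : ℝ))⁻¹ = r := by
    intro r
    by_cases hr : r ∈ F
    · obtain ⟨x, hx, h⟩ := mem_image.1 hr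
      exact ⟨x, fun _ => ⟨mem_filter.1 hx, h⟩⟩
    · exact ⟨1, fun h => absurd h hr⟩
  choose x hx using hex
  have hpos : ∀ r ∈ F, ∀ i, 0 < x r i := fun r hr i => boxTuples_pos (hx r hr).1.1 i
  have hle : ∀ r ∈ F, ∀ i, x r i ≤ N := fun r hr i => boxTuples_le (hx r hr).1.1 i
  set A : ℝ → ℕ := fun r => ∑ i, ∏ j ∈ univ.erase i, x r j
  set B : ℝ → ℕ := fun r => ∏ i, x r i
  have hBpos : ∀ r ∈ F, 0 < B r := fun r hr => prod_pos fun i _ => hpos r hr i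
  have hApos : ∀ r ∈ F, 0 < A r := fun r hr =>
    sum_pos (fun i _ => prod_pos fun j _ => hpos r hr j) ⟨⟨0, hk⟩, mem_univ _⟩
  have hBle : ∀ r ∈ F, B r ≤ N ^ k := fun r hr => by
    have := prod_le_pow_card univ (x r) N fun i _ => hle r hr i
    simpa using this
  have hAle : ∀ r ∈ F, A r ≤ k * N ^ (k - 1) := fun r hr => by
    have : ∀ i ∈ (univ : Finset (Fin k)), ∏ j ∈ univ.erase i, x r j ≤ N ^ (k - 1) := fun i _ => by
      have := prod_le_pow_card (univ.erase i) (x r) N fun i _ => hle r hr i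
      simpa using this
    have := sum_le_card_nsmul _ _ _ this
    simpa using this
  have hslope : ∀ r ∈ F, r = (A r : ℝ) / B r := fun r hr => by
    rw [eq_div_iff (by exact_mod_cast (hBpos r hr).ne')]
    have := sum_inv_mul_prod (K := ℝ) (x r) fun i => by exact_mod_cast (hpos r hr i).ne'
    rwa [(hx r hr).2] at this
  have hmod : ∀ r ∈ F, b * (B r : ZMod p) = (A r : ZMod p) := fun r hr => by
    rw [← (hx r hr).1.2]
    refine sum_inv_mul_prod (x r) fun i h => ?_
    rw [ZMod.natCast_eq_zero_iff] at h
    exact absurd (Nat.le_of_dvd (hpos r hr i) h) (not_le.2 ((hle r hr i).trans_lt hNp))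
  have hp0 : (0 : ℝ) < p := by exact_mod_cast (Fact.out : p.Prime).pos
  have hN0 : (0 : ℝ) < N := by exact_mod_cast hN
  have hk0 : (0 : ℝ) < k := by exact_mod_cast hk
  have hmain := card_slopes_le F (p := p) (U := k * (N : ℝ) ^ (k - 1)) (V := (N : ℝ) ^ k) hp0
    (by positivity) (by positivity) (fun r => A r) (fun r => B r)
    (fun r hr => ⟨by exact_mod_cast hApos r hr, by exact_mod_cast hAle r hr⟩)
    (fun r hr => ⟨by exact_mod_cast hBpos r hr, by exact_mod_cast hBle r hr⟩) hslope (by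
      intro r hr s hs hlt
      have h1 : (0 : ℝ) < (A r : ℝ) * B s - A s * B r := by
        rw [hslope r hr, hslope s hs, div_lt_div_iff₀ (by exact_mod_cast hBpos s hs)
          (by exact_mod_cast hBpos r hr)] at hlt
        linarith
      have h2 : (0 : ℤ) < (A r : ℤ) * B s - A s * B r := by exact_mod_cast h1
      have h3 : (p : ℤ) ∣ (A r : ℤ) * B s - A s * B r := by
        rw [← ZMod.intCast_zmod_eq_zero_iff_dvd]
        push_cast
        rw [← hmod r hr, ← hmod s hs]
        ring
      exact_mod_cast Int.le_of_dvd h2 h3)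
  refine hmain.trans ?_
  have hpow : (N : ℝ) ^ (k - 1) * (N : ℝ) ^ k = (N : ℝ) ^ (2 * k - 1) := by
    rw [← pow_add]; congr 1; omega
  have hk1 : (1 : ℝ) ≤ k := by exact_mod_cast hk
  rw [mul_assoc, mul_assoc, hpow, mul_div_assoc]
  nlinarith

lemma card_sum_inv_zmod_eq_le {p : ℕ} [Fact p.Prime] {k N : ℕ} (hk : 0 < k) (hN : 0 < N)
    (hNp : N < p) (hp3 : 3 ≤ p) :
    (#{z ∈ boxTuples k N ×ˢ boxTuples k N |
        ∑ i, ((z.1 i : ZMod p))⁻¹ = ∑ i, ((z.2 i : ZMod p))⁻¹} : ℝ) ≤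
      (2 * k : ℝ) ^ (90 * k ^ 3) * Real.log p ^ (4 * k ^ 2) *
        (((N : ℝ) ^ (2 * k - 1) / p + 1) * (N : ℝ) ^ k) := by
  classical
  have h := card_collisions_le (boxTuples k N) (fun x => ∑ i, ((x i : ZMod p))⁻¹)
    (fun x => ∑ i, ((x i : ℝ))⁻¹) (by positivity) (card_image_sum_inv_le hk hN hNp)
  refine h.trans ?_
  have hQ := card_sum_inv_eq_le k N
  have hRQ : ∀ x y : Fin k → ℕ, (∑ i, ((x i : ℝ))⁻¹ = ∑ i, ((y i : ℝ))⁻¹ ↔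
      ∑ i, ((x i : ℚ))⁻¹ = ∑ i, ((y i : ℚ))⁻¹) := fun x y => by
    rw [← (Rat.cast_injective (α := ℝ)).eq_iff]
    push_cast
    rfl
  simp only [hRQ]
  have hlog1 : 1 ≤ Real.log p := by
    rw [Real.le_log_iff_exp_le (by positivity)]
    have : (3 : ℝ) ≤ p := by exact_mod_cast hp3
    linarith [Real.exp_one_lt_d9]
  have hlogN : 0 ≤ Real.log N := Real.log_natCast_nonneg N
  have hlog : 1 + Real.log N ≤ 2 * Real.log p := by
    have : Real.log N ≤ Real.log p :=
      Real.log_le_log (by exact_mod_cast hN) (by exact_mod_cast hNp.le)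
    linarith
  have hk1 : (1 : ℝ) ≤ k := by exact_mod_cast hk
  have hconst : (2 * k : ℝ) * (2 ^ (4 * k ^ 2) * 3 ^ (8 * k ^ 3)) ≤ (2 * k) ^ (90 * k ^ 3) := by
    have hb : (2 : ℝ) ≤ 2 * k := by linarith
    calc (2 * k : ℝ) * (2 ^ (4 * k ^ 2) * 3 ^ (8 * k ^ 3))
        ≤ (2 * k : ℝ) * ((2 * k : ℝ) ^ (4 * k ^ 2) * ((2 * k : ℝ) ^ 2) ^ (8 * k ^ 3)) := by
          have : (3 : ℝ) ≤ (2 * k) ^ 2 := by nlinarith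
          gcongr
      _ = (2 * k : ℝ) ^ (1 + 4 * k ^ 2 + 16 * k ^ 3) := by
          rw [← pow_mul, pow_add, pow_add]; ring
      _ ≤ _ := by
          refine pow_le_pow_right₀ (by linarith) ?_
          have h1 : k ^ 2 ≤ k ^ 3 := Nat.pow_le_pow_right hk (by norm_num)
          have h2 : 1 ≤ k ^ 3 := Nat.one_le_pow _ _ hk
          omega
  calc _ ≤ 2 * k * ((N : ℝ) ^ (2 * k - 1) / p + 1) *
        ((N : ℝ) ^ k * ((2 * Real.log p) ^ (4 * k ^ 2) * 3 ^ (8 * k ^ 3))) := by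
        refine mul_le_mul_of_nonneg_left (hQ.trans ?_) (by positivity)
        gcongr
    _ = (2 * k * (2 ^ (4 * k ^ 2) * 3 ^ (8 * k ^ 3))) * Real.log p ^ (4 * k ^ 2) *
        (((N : ℝ) ^ (2 * k - 1) / p + 1) * (N : ℝ) ^ k) := by rw [mul_pow]; ring
    _ ≤ _ := by gcongr

end Energy

section Fourier

variable {p : ℕ} [Fact p.Prime]

lemma ep_eq_stdAddChar (z : ZMod p) : ep p z = ZMod.stdAddChar z := by
  rw [ZMod.stdAddChar_apply, ZMod.toCircle_apply, ep]

lemma sum_norm_sq_le {X : Type*} (S : Finset X) (f : X → ZMod p) (c : X → ℂ)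
    (hc : ∀ x ∈ S, ‖c x‖ ≤ 1) {a : ZMod p} (ha : a ≠ 0) :
    ∑ μ : ZMod p, ‖∑ x ∈ S, c x * ZMod.stdAddChar (a * μ * f x)‖ ^ 2 ≤
      p * #{z ∈ S ×ˢ S | f z.1 = f z.2} := by
  have h1 : ((∑ μ : ZMod p, ‖∑ x ∈ S, c x * ZMod.stdAddChar (a * μ * f x)‖ ^ 2 : ℝ) : ℂ) =
      ∑ z ∈ S ×ˢ S, c z.1 * (starRingEnd ℂ) (c z.2) *
        ∑ μ : ZMod p, ZMod.stdAddChar (μ * (a * (f z.1 - f z.2))) := by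
    push_cast
    simp_rw [← Complex.mul_conj', map_sum, sum_mul_sum, mul_sum]
    rw [sum_product, sum_comm]
    refine sum_congr rfl fun x _ => ?_
    rw [sum_comm]
    refine sum_congr rfl fun y _ => sum_congr rfl fun μ _ => ?_
    dsimp only
    rw [RingHom.map_mul, ← AddChar.map_neg_eq_conj,
      show μ * (a * (f x - f y)) = a * μ * f x + -(a * μ * f y) by ring,
      AddChar.map_add_eq_mul]
    ring
  have h2 : ‖((∑ μ : ZMod p, ‖∑ x ∈ S, c x * ZMod.stdAddChar (a * μ * f x)‖ ^ 2 : ℝ) : ℂ)‖ ≤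
      p * #{z ∈ S ×ˢ S | f z.1 = f z.2} := by
    rw [h1, mul_comm, ← nsmul_eq_mul, ← sum_const, sum_filter]
    refine (norm_sum_le _ _).trans (sum_le_sum fun z hz => ?_)
    obtain ⟨hz1, hz2⟩ := mem_product.1 hz
    rw [AddChar.sum_mulShift _ (ZMod.isPrimitive_stdAddChar p)]
    simp only [mul_eq_zero, ha, false_or, sub_eq_zero]
    split_ifs
    · rw [norm_mul, norm_mul, RCLike.norm_conj, ZMod.card, Complex.norm_natCast]
      exact mul_le_of_le_one_left (Nat.cast_nonneg p)
        (mul_le_one₀ (hc _ hz1) (norm_nonneg _) (hc _ hz2))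
    · simp
  rwa [Complex.norm_real, Real.norm_of_nonneg (by positivity)] at h2

lemma sq_sum_comp_le {X : Type*} (S : Finset X) (f : X → ZMod p) (h : ZMod p → ℝ) :
    (∑ x ∈ S, h (f x)) ^ 2 ≤ #{z ∈ S ×ˢ S | f z.1 = f z.2} * ∑ μ, h μ ^ 2 := by
  have h1 : ∑ x ∈ S, h (f x) = ∑ μ, (#{x ∈ S | f x = μ} : ℝ) * h μ := by
    rw [← sum_fiberwise S f]
    refine sum_congr rfl fun μ _ => ?_
    rw [← nsmul_eq_mul, ← sum_const]
    exact sum_congr rfl fun x hx => by rw [(mem_filter.1 hx).2]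
  rw [h1, card_fiber_eq_sum S f univ fun _ _ => mem_univ _, Nat.cast_sum]
  simp only [Nat.cast_pow]
  exact sum_mul_sq_le_sq_mul_sq _ _ _

lemma sum_pow_eq_sum_boxTuples (k N : ℕ) (c : ℕ → ℂ) (b : ZMod p) :
    (∑ x ∈ Icc 1 N, c x * ZMod.stdAddChar (b * (x : ZMod p)⁻¹)) ^ k =
      ∑ x ∈ boxTuples k N, (∏ i, c (x i)) *
        ZMod.stdAddChar (b * ∑ i, ((x i : ZMod p))⁻¹) := by
  rw [sum_pow']
  refine sum_congr rfl fun x _ => ?_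
  rw [prod_mul_distrib, mul_sum]
  congr 1
  exact (map_prod (ZMod.stdAddChar (N := p)).toMonoidHom
    (fun i => Multiplicative.ofAdd (b * ((x i : ZMod p))⁻¹)) univ).symm

lemma norm_prod_le_one {k N : ℕ} {c : ℕ → ℂ} (hc : ∀ x ∈ Icc 1 N, ‖c x‖ ≤ 1)
    {x : Fin k → ℕ} (hx : x ∈ boxTuples k N) : ‖∏ i, c (x i)‖ ≤ 1 := by
  rw [norm_prod]
  exact prod_le_one (fun _ _ => norm_nonneg _) fun i _ => hc _ (Fintype.mem_piFinset.1 hx i)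

lemma pow_sum_le_card_pow_mul {X : Type*} (S : Finset X) (f : X → ℝ) (hf : ∀ x ∈ S, 0 ≤ f x)
    {k : ℕ} (hk : 0 < k) : (∑ x ∈ S, f x) ^ k ≤ (#S : ℝ) ^ (k - 1) * ∑ x ∈ S, f x ^ k := by
  obtain ⟨n, rfl⟩ := Nat.exists_eq_succ_of_ne_zero hk.ne'
  rcases S.eq_empty_or_nonempty with rfl | hS
  · simp
  have hc : (0 : ℝ) < (#S : ℝ) ^ n := pow_pos (by exact_mod_cast hS.card_pos) n
  have := pow_sum_div_card_le_sum_pow hf n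
  rwa [div_le_iff₀' hc] at this

lemma exists_norm_le_one_mul_eq_norm (z : ℂ) : ∃ θ : ℂ, ‖θ‖ ≤ 1 ∧ θ * z = (‖z‖ : ℂ) := by
  by_cases hz : z = 0
  · exact ⟨0, by simp, by simp [hz]⟩
  · have h0 : (‖z‖ : ℂ) ≠ 0 := by simpa using hz
    refine ⟨(starRingEnd ℂ) z / ‖z‖, by simp [hz], ?_⟩
    rw [div_mul_eq_mul_div, Complex.conj_mul', sq, mul_div_cancel_right₀ _ h0]

/-- Bilinear sums over reciprocals are controlled by the two additive energies. -/
lemma norm_bilinear_pow_le (N1 N2 : ℕ) {k1 k2 : ℕ} (hk1 : 0 < k1) (hk2 : 0 < k2)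
    {a : ZMod p} (ha : a ≠ 0) (α1 α2 : ℕ → ℂ) (hα1 : ∀ x ∈ Icc 1 N1, ‖α1 x‖ ≤ 1)
    (hα2 : ∀ x ∈ Icc 1 N2, ‖α2 x‖ ≤ 1) :
    ‖∑ x1 ∈ Icc 1 N1, ∑ x2 ∈ Icc 1 N2, α1 x1 * α2 x2 *
        ZMod.stdAddChar (a * (x1 : ZMod p)⁻¹ * (x2 : ZMod p)⁻¹)‖ ^ (2 * k1 * k2) ≤
      (N1 : ℝ) ^ (2 * k1 * (k2 - 1)) * (N2 : ℝ) ^ (2 * k2 * (k1 - 1)) *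
        (p * #{z ∈ boxTuples k1 N1 ×ˢ boxTuples k1 N1 |
            ∑ i, ((z.1 i : ZMod p))⁻¹ = ∑ i, ((z.2 i : ZMod p))⁻¹} *
          #{z ∈ boxTuples k2 N2 ×ˢ boxTuples k2 N2 |
            ∑ i, ((z.1 i : ZMod p))⁻¹ = ∑ i, ((z.2 i : ZMod p))⁻¹}) := by
  set J1 := #{z ∈ boxTuples k1 N1 ×ˢ boxTuples k1 N1 |
    ∑ i, ((z.1 i : ZMod p))⁻¹ = ∑ i, ((z.2 i : ZMod p))⁻¹}
  set J2 := #{z ∈ boxTuples k2 N2 ×ˢ boxTuples k2 N2 |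
    ∑ i, ((z.1 i : ZMod p))⁻¹ = ∑ i, ((z.2 i : ZMod p))⁻¹}
  set G : ℕ → ℂ := fun x1 => ∑ x2 ∈ Icc 1 N2, α2 x2 *
    ZMod.stdAddChar (a * (x1 : ZMod p)⁻¹ * (x2 : ZMod p)⁻¹) with hG
  choose θ hθ1 hθ using fun x1 => exists_norm_le_one_mul_eq_norm (G x1 ^ k2)
  set g : ZMod p → ℂ := fun μ => ∑ x1 ∈ Icc 1 N1, θ x1 *
    ZMod.stdAddChar (a * μ * (x1 : ZMod p)⁻¹) with hg
  set T : ℝ := ∑ x1 ∈ Icc 1 N1, ‖G x1‖ ^ k2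
  set f : (Fin k2 → ℕ) → ZMod p := fun y => ∑ i, ((y i : ZMod p))⁻¹ with hf
  set W : ℝ := ∑ y ∈ boxTuples k2 N2, ‖g (f y)‖ ^ k1
  have hS : ‖∑ x1 ∈ Icc 1 N1, ∑ x2 ∈ Icc 1 N2, α1 x1 * α2 x2 *
      ZMod.stdAddChar (a * (x1 : ZMod p)⁻¹ * (x2 : ZMod p)⁻¹)‖ ^ k2 ≤
        (N1 : ℝ) ^ (k2 - 1) * T := by
    have h1 : ‖∑ x1 ∈ Icc 1 N1, ∑ x2 ∈ Icc 1 N2, α1 x1 * α2 x2 *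
        ZMod.stdAddChar (a * (x1 : ZMod p)⁻¹ * (x2 : ZMod p)⁻¹)‖ ≤ ∑ x1 ∈ Icc 1 N1, ‖G x1‖ := by
      refine norm_sum_le_of_le _ fun x hx => ?_
      simp_rw [mul_assoc (α1 x), ← mul_sum]
      rw [norm_mul]
      exact mul_le_of_le_one_left (norm_nonneg _) (hα1 x hx)
    refine (pow_le_pow_left₀ (norm_nonneg _) h1 k2).trans ?_
    simpa using pow_sum_le_card_pow_mul (Icc 1 N1) (fun x => ‖G x‖) (fun _ _ => norm_nonneg _) hk2
  have hT : T ≤ ∑ y ∈ boxTuples k2 N2, ‖g (f y)‖ := by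
    have h1 : (T : ℂ) = ∑ y ∈ boxTuples k2 N2, (∏ i, α2 (y i)) * g (f y) := by
      have : (T : ℂ) = ∑ x1 ∈ Icc 1 N1, θ x1 * G x1 ^ k2 := by
        simp only [T, hθ]
        push_cast
        simp
      rw [this]
      simp only [hG, hg, sum_pow_eq_sum_boxTuples, mul_sum]
      rw [sum_comm]
      refine sum_congr rfl fun y _ => sum_congr rfl fun x _ => ?_
      rw [mul_right_comm a, ← mul_sum]
      simp only [hf]
      ring
    have h2 : ‖(T : ℂ)‖ ≤ ∑ y ∈ boxTuples k2 N2, ‖g (f y)‖ := by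
      rw [h1]
      refine norm_sum_le_of_le _ fun y hy => ?_
      rw [norm_mul]
      exact mul_le_of_le_one_left (norm_nonneg _) (norm_prod_le_one hα2 hy)
    rwa [Complex.norm_real, Real.norm_of_nonneg (by positivity)] at h2
  have hTW : T ^ k1 ≤ (N2 : ℝ) ^ (k2 * (k1 - 1)) * W := by
    refine (pow_le_pow_left₀ (by positivity) hT k1).trans ?_
    have := pow_sum_le_card_pow_mul (boxTuples k2 N2) (fun y => ‖g (f y)‖)
      (fun _ _ => norm_nonneg _) hk1
    simpa [Fintype.card_piFinset_const, ← pow_mul] using this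
  have hW : W ^ 2 ≤ p * J1 * J2 := by
    refine (sq_sum_comp_le (boxTuples k2 N2) f fun μ => ‖g μ‖ ^ k1).trans ?_
    have h1 : ∑ μ, (‖g μ‖ ^ k1) ^ 2 ≤ p * J1 := by
      have := sum_norm_sq_le (boxTuples k1 N1) (fun x => ∑ i, ((x i : ZMod p))⁻¹)
        (fun x => ∏ i, θ (x i)) (fun x hx => norm_prod_le_one (fun y _ => hθ1 y) hx) ha
      simp_rw [← sum_pow_eq_sum_boxTuples, norm_pow] at this
      exact this
    rw [mul_comm]
    exact mul_le_mul_of_nonneg_right h1 (Nat.cast_nonneg _)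
  have hT0 : 0 ≤ T := by positivity
  calc _ = ((‖∑ x1 ∈ Icc 1 N1, ∑ x2 ∈ Icc 1 N2, α1 x1 * α2 x2 *
        ZMod.stdAddChar (a * (x1 : ZMod p)⁻¹ * (x2 : ZMod p)⁻¹)‖ ^ k2) ^ k1) ^ 2 := by
        rw [← pow_mul, ← pow_mul]; congr 1; ring
    _ ≤ (((N1 : ℝ) ^ (k2 - 1) * T) ^ k1) ^ 2 := by gcongr
    _ = (((N1 : ℝ) ^ (k2 - 1)) ^ k1 * T ^ k1) ^ 2 := by rw [mul_pow]
    _ ≤ (((N1 : ℝ) ^ (k2 - 1)) ^ k1 * ((N2 : ℝ) ^ (k2 * (k1 - 1)) * W)) ^ 2 := by gcongr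
    _ = (N1 : ℝ) ^ (2 * k1 * (k2 - 1)) * (N2 : ℝ) ^ (2 * k2 * (k1 - 1)) * W ^ 2 := by
        ring
    _ ≤ _ := by gcongr

end Fourier

lemma sqrt_mul_energy_bound_eq {k : ℕ} (hk : 0 < k) {N p : ℝ} (hN : 0 < N) (hp : 0 < p) :
    p ^ ((1 : ℝ) / 2) * ((N ^ (2 * k - 1) / p + 1) * N ^ k) =
      N ^ (2 * k) * (N ^ (k - 1) / p ^ ((1 : ℝ) / 2) + p ^ ((1 : ℝ) / 2) / N ^ k) := by
  have hs : p = p ^ ((1 : ℝ) / 2) * p ^ ((1 : ℝ) / 2) := by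
    rw [← Real.rpow_add hp]; norm_num
  have hs0 : 0 < p ^ ((1 : ℝ) / 2) := Real.rpow_pos_of_pos hp _
  set s := p ^ ((1 : ℝ) / 2)
  obtain ⟨n, rfl⟩ : ∃ n, k = n + 1 := ⟨k - 1, by omega⟩
  rw [hs, show 2 * (n + 1) - 1 = 2 * n + 1 by omega, Nat.add_sub_cancel]
  field_simp
  ring

/-- the fully explicit bilinear Kloosterman sum bound over
`I_1 = [1,N_1]`, `I_2 = [1,N_2]` with parameters `k_1, k_2`. -/
theorem stmt_8 (p : ℕ) (hp : p.Prime) (hp3 : 3 ≤ p) (N1 N2 : ℕ)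
    (hN1 : 2 ≤ N1) (hN1p : N1 < p) (hN2 : 2 ≤ N2) (hN2p : N2 < p)
    (k1 k2 : ℕ) (hk1 : 0 < k1) (hk2 : 0 < k2)
    (a : ℤ) (ha : Int.gcd a p = 1)
    (α1 α2 : ℕ → ℂ)
    (hα1 : ∀ x ∈ Finset.Icc 1 N1, ‖α1 x‖ ≤ 1)
    (hα2 : ∀ x ∈ Finset.Icc 1 N2, ‖α2 x‖ ≤ 1) :
    ‖∑ x1 ∈ Finset.Icc 1 N1, ∑ x2 ∈ Finset.Icc 1 N2,
        α1 x1 * α2 x2 * ep p ((a : ZMod p) * (x1 : ZMod p)⁻¹ * (x2 : ZMod p)⁻¹)‖ ≤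
      (2 * (k1 : ℝ)) ^ ((45 * (k1 : ℝ) ^ 2) / (k2 : ℝ)) *
        (2 * (k2 : ℝ)) ^ ((45 * (k2 : ℝ) ^ 2) / (k1 : ℝ)) *
        Real.log p ^ (2 * ((k1 : ℝ) / (k2 : ℝ) + (k2 : ℝ) / (k1 : ℝ))) *
        ((N1 : ℝ) ^ (k1 - 1) / (p : ℝ) ^ ((1 : ℝ) / 2) +
            (p : ℝ) ^ ((1 : ℝ) / 2) / (N1 : ℝ) ^ k1) ^ ((1 : ℝ) / (2 * (k1 : ℝ) * k2)) *
        ((N2 : ℝ) ^ (k2 - 1) / (p : ℝ) ^ ((1 : ℝ) / 2) +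
            (p : ℝ) ^ ((1 : ℝ) / 2) / (N2 : ℝ) ^ k2) ^ ((1 : ℝ) / (2 * (k1 : ℝ) * k2)) *
        (N1 : ℝ) * (N2 : ℝ) := by
  have : Fact p.Prime := ⟨hp⟩
  have ha0 : (a : ZMod p) ≠ 0 := by
    rw [Ne, ZMod.intCast_zmod_eq_zero_iff_dvd]
    intro h
    have h1 := Int.dvd_coe_gcd h dvd_rfl
    rw [ha] at h1
    exact hp.one_lt.ne' (Nat.dvd_one.1 (Int.natCast_dvd_natCast.1 h1))
  have hp0 : (0 : ℝ) < p := by exact_mod_cast hp.pos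
  have hN10 : (0 : ℝ) < N1 := by exact_mod_cast (by omega : 0 < N1)
  have hN20 : (0 : ℝ) < N2 := by exact_mod_cast (by omega : 0 < N2)
  have hk10 : (0 : ℝ) < k1 := by exact_mod_cast hk1
  have hk20 : (0 : ℝ) < k2 := by exact_mod_cast hk2
  have hlog : 0 ≤ Real.log p := Real.log_natCast_nonneg p
  simp only [ep_eq_stdAddChar]
  have hmain := norm_bilinear_pow_le N1 N2 hk1 hk2 ha0 α1 α2 hα1 hα2
  have hJ1 := card_sum_inv_zmod_eq_le hk1 (by omega) hN1p hp3
  have hJ2 := card_sum_inv_zmod_eq_le hk2 (by omega) hN2p hp3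
  have hQ1 := sqrt_mul_energy_bound_eq hk1 hN10 hp0
  have hQ2 := sqrt_mul_energy_bound_eq hk2 hN20 hp0
  have hs : (p : ℝ) = (p : ℝ) ^ ((1 : ℝ) / 2) * (p : ℝ) ^ ((1 : ℝ) / 2) := by
    rw [← Real.rpow_add hp0]; norm_num
  have hQ10 : 0 ≤ (N1 : ℝ) ^ (k1 - 1) / (p : ℝ) ^ ((1 : ℝ) / 2) +
    (p : ℝ) ^ ((1 : ℝ) / 2) / (N1 : ℝ) ^ k1 := by positivity
  have hQ20 : 0 ≤ (N2 : ℝ) ^ (k2 - 1) / (p : ℝ) ^ ((1 : ℝ) / 2) +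
    (p : ℝ) ^ ((1 : ℝ) / 2) / (N2 : ℝ) ^ k2 := by positivity
  set Q1 := (N1 : ℝ) ^ (k1 - 1) / (p : ℝ) ^ ((1 : ℝ) / 2) +
    (p : ℝ) ^ ((1 : ℝ) / 2) / (N1 : ℝ) ^ k1
  set Q2 := (N2 : ℝ) ^ (k2 - 1) / (p : ℝ) ^ ((1 : ℝ) / 2) +
    (p : ℝ) ^ ((1 : ℝ) / 2) / (N2 : ℝ) ^ k2
  have hm : 2 * k1 * k2 ≠ 0 := by positivity
  have hroot : ∀ {b e : ℝ} (m : ℕ), 0 ≤ b → e * (2 * k1 * k2) = m →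
      (b ^ e) ^ (2 * k1 * k2) = b ^ m := by
    intro b e m hb he
    rw [← Real.rpow_natCast, ← Real.rpow_mul hb, ← Real.rpow_natCast, ← he]
    push_cast
    rfl
  refine (pow_le_pow_iff_left₀ (norm_nonneg _) (by positivity) hm).1 (hmain.trans ?_)
  simp only [mul_pow _ _ (2 * k1 * k2)]
  rw [hroot (90 * k1 ^ 3) (by positivity) (by push_cast; field_simp; ring),
    hroot (90 * k2 ^ 3) (by positivity) (by push_cast; field_simp; ring),
    hroot (4 * k1 ^ 2 + 4 * k2 ^ 2) hlog (by push_cast; field_simp; ring),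
    hroot 1 hQ10 (by push_cast; field_simp), hroot 1 hQ20 (by push_cast; field_simp)]
  have hexp1 : 2 * k1 * k2 = 2 * k1 * (k2 - 1) + 2 * k1 := by
    rw [← Nat.mul_succ, Nat.succ_eq_add_one, Nat.sub_add_cancel hk2]
  have hexp2 : 2 * k1 * k2 = 2 * k2 * (k1 - 1) + 2 * k2 := by
    rw [← Nat.mul_succ, Nat.succ_eq_add_one, Nat.sub_add_cancel hk1, mul_right_comm]
  have hpow1 : (N1 : ℝ) ^ (2 * k1 * k2) = (N1 : ℝ) ^ (2 * k1 * (k2 - 1)) * (N1 : ℝ) ^ (2 * k1) := by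
    rw [← pow_add, ← hexp1]
  have hpow2 : (N2 : ℝ) ^ (2 * k1 * k2) = (N2 : ℝ) ^ (2 * k2 * (k1 - 1)) * (N2 : ℝ) ^ (2 * k2) := by
    rw [← pow_add, ← hexp2]
  set s := (p : ℝ) ^ ((1 : ℝ) / 2)
  set E1 := ((N1 : ℝ) ^ (2 * k1 - 1) / p + 1) * (N1 : ℝ) ^ k1
  set E2 := ((N2 : ℝ) ^ (2 * k2 - 1) / p + 1) * (N2 : ℝ) ^ k2
  calc _ ≤ (N1 : ℝ) ^ (2 * k1 * (k2 - 1)) * (N2 : ℝ) ^ (2 * k2 * (k1 - 1)) *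
        (p * ((2 * k1 : ℝ) ^ (90 * k1 ^ 3) * Real.log p ^ (4 * k1 ^ 2) * E1) *
          ((2 * k2 : ℝ) ^ (90 * k2 ^ 3) * Real.log p ^ (4 * k2 ^ 2) * E2)) := by
        refine mul_le_mul_of_nonneg_left ?_ (by positivity)
        exact mul_le_mul (mul_le_mul_of_nonneg_left hJ1 hp0.le) hJ2 (Nat.cast_nonneg _)
          (by positivity)
    _ = (N1 : ℝ) ^ (2 * k1 * (k2 - 1)) * (N2 : ℝ) ^ (2 * k2 * (k1 - 1)) *
        ((2 * k1 : ℝ) ^ (90 * k1 ^ 3) * (2 * k2 : ℝ) ^ (90 * k2 ^ 3) *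
          (Real.log p ^ (4 * k1 ^ 2) * Real.log p ^ (4 * k2 ^ 2)) * ((s * E1) * (s * E2))) := by
        rw [hs]; ring
    _ = _ := by
        rw [hQ1, hQ2, hpow1, hpow2, pow_one, pow_one, pow_add (Real.log p)]
        ring
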